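/- For any f ∈ AP(ℝ): (i) the Parseval identity ℰ(|f|²) = Σ_{λ∈ℝ} |ℰf(λ)|² holds; (ii) for every ε > 0 there is a finite set S ⊂ spec(f) such that ℰ_x |f(x) − Σ_{λ∈S} ℰf(λ) e^{2πiλx}|² < ε; (iii) if Σ_{λ∈ℝ} |ℰf(λ)| < ∞, then the series Σ_{λ∈ℝ} ℰf(λ) e^{2πiλx} converges absolutely and uniformly on ℝ and equals f(x). -/

import Mathlib

open MeasureTheory Complex Filter Topology Set
open scoped ENNReal

noncomputable section

/-- The open upper half-plane, as a subset of `ℂ`. -/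
def UHP : Set ℂ := {z : ℂ | 0 < z.im}

/-- A relatively dense subset of `ℝ`. -/
def RelDense (τ : Set ℝ) : Prop := ∃ l > (0:ℝ), ∀ x : ℝ, ∃ t ∈ τ, x < t ∧ t < x + l

/-- Bohr almost periodic continuous functions on `ℝ`. -/
def APR (f : ℝ → ℂ) : Prop :=
  Continuous f ∧ ∀ ε > (0:ℝ), RelDense {t : ℝ | ∀ x : ℝ, ‖f x - f (x + t)‖ ≤ ε}

/-- Holomorphic almost periodic functions on the upper half-plane. -/
def APH (f : ℂ → ℂ) : Prop :=
  DifferentiableOn ℂ f UHP ∧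
  ∀ α β ε : ℝ, 0 < α → α < β → 0 < ε →
    ∃ τ : Set ℝ, RelDense τ ∧
      ∀ t ∈ τ, ∀ z : ℂ, α < z.im → z.im < β → ‖f z - f (z + (t : ℂ))‖ ≤ ε

/-- `HasMeanAt f y lam c` : the mean `(1/2T)∫_{-T+iy}^{T+iy} f(z) e^{-2πiλz} dz` tends to `c`. -/
def HasMeanAt (f : ℂ → ℂ) (y lam : ℝ) (c : ℂ) : Prop :=
  Tendsto (fun T : ℝ => (1 / (2 * (T : ℂ))) *
      ∫ x in (-T)..T, f ((x : ℂ) + (y : ℂ) * Complex.I) *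
        Complex.exp (-(2 * (Real.pi : ℂ) * Complex.I * (lam : ℂ) * ((x : ℂ) + (y : ℂ) * Complex.I))))
    atTop (𝓝 c)

/-- `HasMeanR f lam c` : the Bohr mean `(1/2T)∫_{-T}^{T} f(x) e^{-2πiλx} dx` tends to `c`. -/
def HasMeanR (f : ℝ → ℂ) (lam : ℝ) (c : ℂ) : Prop :=
  Tendsto (fun T : ℝ => (1 / (2 * (T : ℂ))) *
      ∫ x in (-T)..T, f x *
        Complex.exp (-(2 * (Real.pi : ℂ) * Complex.I * (lam : ℂ) * (x : ℂ))))
    atTop (𝓝 c)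

/-- The spectrum of a function on the upper half-plane: frequencies where the mean is not `0`. -/
def specH (f : ℂ → ℂ) : Set ℝ := {lam : ℝ | ∃ y > (0:ℝ), ¬ HasMeanAt f y lam 0}

/-- A locally finite subset of `ℝ`. -/
def LocFinSet (S : Set ℝ) : Prop := ∀ a b : ℝ, (S ∩ Set.Ioo a b).Finite

/-- A uniformly discrete subset of `ℝ`. -/
def UnifDiscrete (S : Set ℝ) : Prop :=
  ∃ d > (0:ℝ), ∀ x ∈ S, ∀ y ∈ S, x ≠ y → d ≤ |x - y|

/-- Locally summable coefficient functions. -/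
def LocSummable (a : ℝ → ℂ) : Prop :=
  (Function.support a).Countable ∧
  ∀ T > (0:ℝ), Summable (Set.indicator (Set.Icc (-T) T) fun l => ‖a l‖)

/-- Exponential growth of a coefficient function. -/
def ExpGrowth (a : ℝ → ℂ) : Prop :=
  ∃ c > (0:ℝ), Summable fun lam : ℝ => ‖a lam‖ * Real.exp (-c * |lam|)

/-- `a(-λ) = conj (a(λ))`. -/
def Antipodal (a : ℝ → ℂ) : Prop := ∀ lam : ℝ, a (-lam) = (starRingEnd ℂ) (a lam)

/-- The Fourier transform `φ̂(ξ) = ∫ φ(x) e^{-2πixξ} dx`. -/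
def FT (φ : ℝ → ℂ) (ξ : ℝ) : ℂ :=
  ∫ x : ℝ, φ x * Complex.exp (-(2 * (Real.pi : ℂ) * Complex.I * (x : ℂ) * (ξ : ℂ)))

/-- A complex-valued measure on `ℝ`, encoded by its total variation `ν` together with a
unimodular density `w`, so that `dμ = w dν` and `|μ| = ν`. -/
structure CMeasure where
  ν : Measure ℝ
  w : ℝ → ℂ
  meas : Measurable w
  unit : ∀ᵐ t ∂ν, ‖w t‖ = 1

/-- Integration against a complex measure. -/
def CMeasure.integral (μ : CMeasure) (φ : ℝ → ℂ) : ℂ := ∫ t, φ t * μ.w t ∂μ.ν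

/-- Strongly tempered: every Schwartz function is `|μ|`-integrable. -/
def CMeasure.IsStronglyTempered (μ : CMeasure) : Prop :=
  ∀ φ : SchwartzMap ℝ ℂ, Integrable (fun t => φ t) μ.ν

/-- Real-valued complex measure. -/
def CMeasure.RealValued (μ : CMeasure) : Prop := ∀ᵐ t ∂μ.ν, (μ.w t).im = 0

/-- Nonnegative complex measure. -/
def CMeasure.Nonneg (μ : CMeasure) : Prop := ∀ᵐ t ∂μ.ν, μ.w t = 1

/-- `deg(μ) ≤ n` : `∫ (1+t²)^{-n/2} d|μ| < ∞`. -/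
def CMeasure.DegLE (μ : CMeasure) (n : ℕ) : Prop :=
  Integrable (fun t : ℝ => (1 + t ^ 2) ^ (-(n : ℝ) / 2)) μ.ν

/-- The mass `μ({x})` of an atom. -/
def CMeasure.atom (μ : CMeasure) (x : ℝ) : ℂ := ∫ t in {x}, μ.w t ∂μ.ν

/-- The (closed) support of a measure on `ℝ`. -/
def measSupport (ν : Measure ℝ) : Set ℝ := {x : ℝ | ∀ U ∈ 𝓝 x, ν U ≠ 0}

/-- `(μ, a)` is a Fourier summation pair. -/
def IsFSPair (μ : CMeasure) (a : ℝ → ℂ) : Prop :=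
  μ.IsStronglyTempered ∧ LocSummable a ∧
    ∀ φ : ℝ → ℂ, ContDiff ℝ (⊤ : ℕ∞) φ → HasCompactSupport φ →
      μ.integral (FT φ) = ∑' lam : ℝ, a lam * φ lam

/-- Trigonometric polynomials. -/
def IsTrigPoly (f : ℂ → ℂ) : Prop :=
  ∃ (N : ℕ) (p : Fin N → ℂ) (θ : Fin N → ℝ),
    ∀ z : ℂ, f z = ∑ n, p n * Complex.exp (2 * (Real.pi : ℂ) * Complex.I * (θ n : ℂ) * z)

/-- Functions of bounded type on the upper half-plane. -/
def BoundedType (g : ℂ → ℂ) : Prop :=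
  ∃ P Q : ℂ → ℂ, DifferentiableOn ℂ P UHP ∧ DifferentiableOn ℂ Q UHP ∧
    (∃ C : ℝ, ∀ z ∈ UHP, ‖P z‖ ≤ C) ∧ (∃ C : ℝ, ∀ z ∈ UHP, ‖Q z‖ ≤ C) ∧
    (∀ z ∈ UHP, Q z ≠ 0) ∧ ∀ z ∈ UHP, g z = P z / Q z

/-- Mean type `ϑ(g) = limsup_{y→∞} log|g(iy)|/y`. -/
def MeanType (g : ℂ → ℂ) : ℝ :=
  Filter.limsup (fun y : ℝ => Real.log ‖g ((y : ℂ) * Complex.I)‖ / y) atTop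

/-- `E*(z) = conj (E (conj z))`. -/
def fstar (E : ℂ → ℂ) : ℂ → ℂ := fun z => (starRingEnd ℂ) (E ((starRingEnd ℂ) z))

/-- Hermite–Biehler class: entire with `|E*(z)| < |E(z)|` on the upper half-plane. -/
def HB (E : ℂ → ℂ) : Prop := Differentiable ℂ E ∧ ∀ z ∈ UHP, ‖fstar E z‖ < ‖E z‖

/-- `A = (E* + E)/2`. -/
def HBA (E : ℂ → ℂ) : ℂ → ℂ := fun z => (fstar E z + E z) / 2

/-- `B = (E* - E)/(2i)`. -/
def HBB (E : ℂ → ℂ) : ℂ → ℂ := fun z => (fstar E z - E z) / (2 * Complex.I)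

/-- `φ` is a phase function for `E`, with derivative `φd > 0`. -/
def IsPhaseFor (φ φd : ℝ → ℝ) (E : ℂ → ℂ) : Prop :=
  (∀ x : ℝ, HasDerivAt φ (φd x) x) ∧ (∀ x : ℝ, 0 < φd x) ∧
    ∀ x : ℝ, (Complex.exp (Complex.I * (φ x : ℂ)) * E (x : ℂ)).im = 0

/-- The points where `φ ≡ 0 (mod π)`. -/
def phaseZeros (φ : ℝ → ℝ) : Set ℝ := {γ : ℝ | ∃ k : ℤ, φ γ = k * Real.pi}

/-- The nonnegative measure `2π Σ_{φ(γ)≡0 (mod π)} (1/φ'(γ)) δ_γ`. -/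
def phaseMeasure (φ φd : ℝ → ℝ) : Measure ℝ :=
  Measure.sum fun γ : phaseZeros φ =>
    (ENNReal.ofReal (2 * Real.pi / φd (γ : ℝ))) • Measure.dirac (γ : ℝ)

/-- `μ` is an `ℕ`-valued nonnegative measure. -/
def CMeasure.NValued (μ : CMeasure) : Prop :=
  μ.Nonneg ∧ ∃ (Λ : Set ℝ) (m : ℝ → ℕ), LocFinSet Λ ∧ (∀ γ ∈ Λ, 0 < m γ) ∧
    μ.ν = Measure.sum fun γ : Λ => (m (γ : ℝ) : ℝ≥0∞) • Measure.dirac (γ : ℝ)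

/-- Bounded on every horizontal substrip of the upper half-plane. -/
def BddOnStrips (f : ℂ → ℂ) : Prop :=
  ∀ ε > (0:ℝ), ∃ C : ℝ, ∀ z : ℂ, ε < z.im → z.im < 1/ε → ‖f z‖ ≤ C

/-- The Fejér-type partial sums in formula (eq:fdef). -/
def fdefSum (a : ℝ → ℂ) (T : ℝ) (z : ℂ) : ℂ :=
  a 0 / 2 + ∑' lam : ℝ,
    Set.indicator (Set.Ioo (0 : ℝ) T)
      (fun l => a l * (1 - (l : ℂ) / (T : ℂ)) *
        Complex.exp (2 * (Real.pi : ℂ) * Complex.I * (l : ℂ) * z)) lam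

/-- If `F` has totally bounded range, the differences of parameters at which the values of `F` are
close form a relatively dense set. -/
lemma relDense_of_totallyBounded {X : Type*} [PseudoMetricSpace X] (F : ℝ → X)
    (hF : TotallyBounded (range F)) {ε : ℝ} (hε : 0 < ε) :
    RelDense {t : ℝ | ∃ s r : ℝ, t = s - r ∧ dist (F s) (F r) ≤ ε} := by
  obtain ⟨A, hAs, hA, hcov⟩ := totallyBounded_iff_subset.1 hF _ (Metric.dist_mem_uniformity hε)
  obtain ⟨B, -, hB, rfl⟩ : ∃ B ⊆ (univ : Set ℝ), B.Finite ∧ A = image F B :=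
    exists_subset_image_finite_and.1 ⟨A, by rwa [image_univ], hA, rfl⟩
  obtain ⟨R, hR⟩ := hB.isBounded.exists_norm_le
  have hR' : 0 ≤ |R| := abs_nonneg R
  refine ⟨2 * |R| + 2, by positivity, fun x => ?_⟩
  obtain ⟨y, ⟨r, hr, rfl⟩, hy⟩ := mem_iUnion₂.1 (hcov (mem_range_self (x + |R| + 1)))
  have h1 := abs_le.1 ((hR r hr).trans (le_abs_self R))
  exact ⟨x + |R| + 1 - r, ⟨_, _, rfl, le_of_lt hy⟩, by linarith, by linarith⟩

namespace APR

variable {f g : ℝ → ℂ}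

protected lemma continuous (hf : APR f) : Continuous f := hf.1

lemma exists_bound (hf : APR f) : ∃ C > 0, ∀ x, ‖f x‖ ≤ C := by
  obtain ⟨l, hl, h⟩ := hf.2 1 one_pos
  obtain ⟨C, hC⟩ := isCompact_Icc.exists_bound_of_continuousOn (s := Icc 0 l) hf.1.continuousOn
  refine ⟨|C| + 1, by positivity, fun x => ?_⟩
  obtain ⟨t, ht, h1, h2⟩ := h (-x)
  have h3 := hC (x + t) ⟨by linarith, by linarith⟩
  have h4 := norm_le_norm_add_norm_sub' (f x) (f (x + t))
  have := ht x
  linarith [le_abs_self C]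

lemma exists_delta (hf : APR f) {ε : ℝ} (hε : 0 < ε) :
    ∃ δ > 0, ∀ x s, |s| ≤ δ → ‖f x - f (x + s)‖ ≤ ε := by
  obtain ⟨l, hl, h⟩ := hf.2 (ε / 3) (by positivity)
  have hu := (isCompact_Icc (a := (-1 : ℝ)) (b := l + 1)).uniformContinuousOn_of_continuous
    hf.1.continuousOn
  obtain ⟨δ, hδ, hu⟩ := Metric.uniformContinuousOn_iff.1 hu (ε / 3) (by positivity)
  refine ⟨min 1 (δ / 2), by positivity, fun x s hs => ?_⟩
  obtain ⟨t, ht, h1, h2⟩ := h (-x)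
  have hs1 := abs_le.1 (hs.trans (min_le_left _ _))
  have hs2 := hs.trans (min_le_right _ _)
  have h3 := hu (x + t) ⟨by linarith, by linarith⟩ (x + s + t) ⟨by linarith, by linarith⟩ (by
    rw [dist_comm, Real.dist_eq, show x + s + t - (x + t) = s by ring]; linarith)
  rw [dist_eq_norm] at h3
  have h4 := ht x
  have h5 := ht (x + s)
  calc ‖f x - f (x + s)‖ = ‖(f x - f (x + t)) + (f (x + t) - f (x + s + t))
        - (f (x + s) - f (x + s + t))‖ := by congr 1; ring
    _ ≤ ‖f x - f (x + t)‖ + ‖f (x + t) - f (x + s + t)‖ + ‖f (x + s) - f (x + s + t)‖ :=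
        (norm_sub_le _ _).trans (by gcongr; exact norm_add_le _ _)
    _ ≤ ε := by linarith

lemma exists_boundedContinuousFunction (hf : APR f) : ∃ F : BoundedContinuousFunction ℝ ℂ, ⇑F = f :=
  let ⟨C, _, hC⟩ := hf.exists_bound
  ⟨.ofNormedAddCommGroup f hf.1 C hC, rfl⟩

end APR

/-- The translate `x ↦ F (x + t)` of a bounded continuous function. -/
def shift (F : BoundedContinuousFunction ℝ ℂ) (t : ℝ) : BoundedContinuousFunction ℝ ℂ :=
  F.compContinuous ⟨fun x => x + t, by fun_prop⟩

@[simp]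
lemma shift_apply (F : BoundedContinuousFunction ℝ ℂ) (t x : ℝ) :
    shift F t x = F (x + t) := rfl

lemma dist_shift_le {F : BoundedContinuousFunction ℝ ℂ} {ε : ℝ} (hε : 0 ≤ ε) {s r : ℝ} :
    dist (shift F s) (shift F r) ≤ ε ↔ ∀ x, ‖F x - F (x + (s - r))‖ ≤ ε := by
  rw [BoundedContinuousFunction.dist_le hε]
  refine ⟨fun h x => ?_, fun h x => ?_⟩
  · have := h (x - r)
    rw [dist_comm, dist_eq_norm] at this
    simpa [sub_add_eq_add_sub, add_sub_assoc] using this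
  · rw [dist_comm, dist_eq_norm]
    have := h (x + r)
    simpa [add_assoc] using this

namespace APR

variable {F G : BoundedContinuousFunction ℝ ℂ}

lemma continuous_shift (hF : APR F) : Continuous (shift F) := by
  refine Metric.continuous_iff.2 fun s ε hε => ?_
  obtain ⟨δ, hδ, h⟩ := hF.exists_delta (half_pos hε)
  refine ⟨δ, hδ, fun r hr => lt_of_le_of_lt ?_ (half_lt_self hε)⟩
  exact (dist_shift_le (by positivity)).2 fun x => h _ _ (by rw [← Real.dist_eq]; exact hr.le)

lemma totallyBounded_range_shift (hF : APR F) : TotallyBounded (range (shift F)) := by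
  refine Metric.totallyBounded_iff.2 fun ε hε => ?_
  obtain ⟨l, hl, h⟩ := hF.2 (ε / 3) (by positivity)
  have hK := (isCompact_Icc (a := (0 : ℝ)) (b := l)).image hF.continuous_shift
  obtain ⟨A, hA, hcov⟩ := Metric.totallyBounded_iff.1 hK.totallyBounded (ε / 2) (by positivity)
  refine ⟨A, hA, ?_⟩
  rintro _ ⟨s, rfl⟩
  obtain ⟨t, ht, h1, h2⟩ := h (-s)
  obtain ⟨y, hy, hys⟩ := mem_iUnion₂.1
    (hcov (mem_image_of_mem _ (⟨by linarith, by linarith⟩ : s + t ∈ Icc 0 l)))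
  refine mem_iUnion₂.2 ⟨y, hy, ?_⟩
  have h3 : dist (shift F (s + t)) (shift F s) ≤ ε / 3 :=
    (dist_shift_le (by positivity)).2 fun x => by simpa using ht x
  rw [Metric.mem_ball] at hys ⊢
  rw [dist_comm] at h3
  linarith [dist_triangle (shift F s) (shift F (s + t)) y]

lemma relDense_inter {f g : ℝ → ℂ} (hf : APR f) (hg : APR g) {ε : ℝ} (hε : 0 < ε) :
    RelDense {t : ℝ | (∀ x, ‖f x - f (x + t)‖ ≤ ε) ∧ ∀ x, ‖g x - g (x + t)‖ ≤ ε} := by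
  obtain ⟨F, rfl⟩ := hf.exists_boundedContinuousFunction
  obtain ⟨G, rfl⟩ := hg.exists_boundedContinuousFunction
  have hK : IsCompact (closure (range (shift F)) ×ˢ closure (range (shift G))) :=
    (hf.totallyBounded_range_shift.closure.isCompact_of_isClosed isClosed_closure).prod
      (hg.totallyBounded_range_shift.closure.isCompact_of_isClosed isClosed_closure)
  obtain ⟨l, hl, h⟩ := relDense_of_totallyBounded (fun t => (shift F t, shift G t))
    (hK.totallyBounded.subset (range_subset_iff.2 fun t =>
      mk_mem_prod (subset_closure (mem_range_self t)) (subset_closure (mem_range_self t)))) hε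
  refine ⟨l, hl, fun x => ?_⟩
  obtain ⟨_, ⟨s, r, rfl, hsr⟩, hx⟩ := h x
  rw [Prod.dist_eq, max_le_iff] at hsr
  exact ⟨s - r, ⟨(dist_shift_le hε.le).1 hsr.1, (dist_shift_le hε.le).1 hsr.2⟩, hx⟩

end APR

lemma RelDense.mono {s t : Set ℝ} (h : RelDense s) (hst : s ⊆ t) : RelDense t :=
  let ⟨l, hl, H⟩ := h
  ⟨l, hl, fun x => let ⟨y, hy, hx⟩ := H x; ⟨y, hst hy, hx⟩⟩

namespace APR

variable {f g : ℝ → ℂ}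

lemma add (hf : APR f) (hg : APR g) : APR fun x => f x + g x := by
  refine ⟨hf.1.add hg.1, fun ε hε => (hf.relDense_inter hg (half_pos hε)).mono ?_⟩
  rintro t ⟨h1, h2⟩ x
  rw [add_sub_add_comm]
  linarith [norm_add_le (f x - f (x + t)) (g x - g (x + t)), h1 x, h2 x]

lemma mul (hf : APR f) (hg : APR g) : APR fun x => f x * g x := by
  obtain ⟨C, hC, hfC⟩ := hf.exists_bound
  obtain ⟨D, hD, hgD⟩ := hg.exists_bound
  refine ⟨hf.1.mul hg.1, fun ε hε =>
    (hf.relDense_inter hg (ε := ε / (C + D)) (by positivity)).mono ?_⟩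
  rintro t ⟨h1, h2⟩ x
  calc ‖f x * g x - f (x + t) * g (x + t)‖
      = ‖(f x - f (x + t)) * g x + f (x + t) * (g x - g (x + t))‖ := by congr 1; ring
    _ ≤ ε / (C + D) * D + C * (ε / (C + D)) := by
        refine (norm_add_le _ _).trans ?_
        rw [norm_mul, norm_mul]
        gcongr
        exacts [h1 x, hgD x, hfC _, h2 x]
    _ = ε := by field_simp; ring

lemma const (c : ℂ) : APR fun _ => c :=
  ⟨continuous_const, fun ε hε => ⟨1, one_pos, fun x => ⟨x + 1 / 2, by simpa using hε.le,
    by linarith, by linarith⟩⟩⟩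

lemma of_dist_le (hf : APR f) {g : ℝ → ℂ} (hg : Continuous g) {C : ℝ} (hC : 0 < C)
    (h : ∀ τ ε, (∀ x, ‖f x - f (x + τ)‖ ≤ ε) → ∀ x, ‖g x - g (x + τ)‖ ≤ C * ε) : APR g :=
  ⟨hg, fun ε hε => (hf.2 (ε / C) (by positivity)).mono fun t ht x =>
    (h t _ ht x).trans_eq (by field_simp)⟩

lemma neg (hf : APR f) : APR fun x => -f x :=
  hf.of_dist_le hf.1.neg one_pos fun τ ε h x => by
    rw [← neg_sub_neg, neg_neg, neg_neg, ← norm_neg, neg_sub, norm_sub_rev, one_mul]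
    simpa [norm_sub_rev] using h x

lemma sub (hf : APR f) (hg : APR g) : APR fun x => f x - g x := by
  simpa only [sub_eq_add_neg] using hf.add hg.neg

lemma sum {ι : Type*} (S : Finset ι) {u : ι → ℝ → ℂ} (hu : ∀ i ∈ S, APR (u i)) :
    APR fun x => ∑ i ∈ S, u i x := by
  classical
  induction S using Finset.induction_on with
  | empty => simpa using const 0
  | insert i S hi ih =>
    simp_rw [Finset.sum_insert hi]
    exact (hu i (Finset.mem_insert_self i S)).add
      (ih fun j hj => hu j (Finset.mem_insert_of_mem hj))

lemma of_tendstoUniformly {ι : Type*} {p : Filter ι} [p.NeBot] {u : ι → ℝ → ℂ}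
    (hu : ∀ i, APR (u i)) (h : TendstoUniformly u f p) : APR f := by
  refine ⟨h.continuous (Frequently.of_forall fun i => (hu i).1), fun ε hε => ?_⟩
  obtain ⟨i, hi⟩ := (Metric.tendstoUniformly_iff.1 h (ε / 3) (by positivity)).exists
  refine ((hu i).2 (ε / 3) (by positivity)).mono fun t ht x => ?_
  have h1 := hi x
  have h2 := hi (x + t)
  rw [dist_eq_norm] at h1 h2
  have h3 := ht x
  calc ‖f x - f (x + t)‖ = ‖(f x - u i x) + (u i x - u i (x + t))
        - (f (x + t) - u i (x + t))‖ := by congr 1; ring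
    _ ≤ ‖f x - u i x‖ + ‖u i x - u i (x + t)‖ + ‖f (x + t) - u i (x + t)‖ :=
        (norm_sub_le _ _).trans (by gcongr; exact norm_add_le _ _)
    _ ≤ ε := by linarith

end APR

/-- The character `x ↦ exp (2πiλx)`. -/
def character (lam x : ℝ) : ℂ := cexp (2 * (Real.pi : ℂ) * I * (lam : ℂ) * (x : ℂ))

@[fun_prop]
lemma continuous_character (lam : ℝ) : Continuous (character lam) := by
  unfold character; fun_prop

lemma character_add (lam x y : ℝ) :
    character lam (x + y) = character lam x * character lam y := by
  rw [character, character, character, ← Complex.exp_add]; push_cast; ring_nf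

lemma character_add_left (lam mu x : ℝ) :
    character (lam + mu) x = character lam x * character mu x := by
  rw [character, character, character, ← Complex.exp_add]; push_cast; ring_nf

lemma character_eq (lam x : ℝ) :
    character lam x = cexp ((2 * Real.pi * lam * x : ℝ) * I) := by
  rw [character]; push_cast; ring_nf

lemma character_neg (lam x : ℝ) :
    character (-lam) x = cexp (-(2 * (Real.pi : ℂ) * I * (lam : ℂ) * (x : ℂ))) := by
  rw [character]; push_cast; ring_nf

lemma conj_character (lam x : ℝ) : (starRingEnd ℂ) (character lam x) = character (-lam) x := by
  rw [character_eq, character_eq, ← Complex.exp_conj, map_mul, conj_I, conj_ofReal]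
  push_cast; ring_nf

@[simp]
lemma norm_character (lam x : ℝ) : ‖character lam x‖ = 1 := by
  rw [character_eq, Complex.norm_exp_ofReal_mul_I]

@[simp]
lemma character_zero (lam : ℝ) : character lam 0 = 1 := by simp [character]

@[simp]
lemma character_zero_left (x : ℝ) : character 0 x = 1 := by simp [character]

lemma character_mul_neg (lam x : ℝ) : character lam x * character (-lam) x = 1 := by
  rw [← character_add_left]; simp

lemma norm_character_sub_one_le (lam x : ℝ) :
    ‖character lam x - 1‖ ≤ 2 * Real.pi * |lam| * |x| := by
  rw [character_eq, mul_comm _ I]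
  refine (Real.norm_exp_I_mul_ofReal_sub_one_le).trans_eq ?_
  rw [Real.norm_eq_abs, abs_mul, abs_mul, abs_of_pos (by positivity : 0 < 2 * Real.pi)]

lemma apr_character (lam : ℝ) : APR (character lam) := by
  rcases eq_or_ne lam 0 with rfl | h
  · simpa [funext character_zero_left] using APR.const 1
  refine ⟨continuous_character lam, fun ε hε => ⟨2 * |1 / lam|, by positivity, fun x => ?_⟩⟩
  have hp : 0 < |1 / lam| := by positivity
  have h1 : |1 / lam| ⁻¹ * |1 / lam| = 1 := inv_mul_cancel₀ hp.ne'
  refine ⟨(⌊|1 / lam|⁻¹ * x⌋ + 1 : ℤ) * |1 / lam|, fun y => ?_, ?_, ?_⟩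
  · have : character lam ((⌊|1 / lam|⁻¹ * x⌋ + 1 : ℤ) * |1 / lam|) = 1 := by
      rw [character, Complex.exp_eq_one_iff]
      have hl : (lam : ℂ) ≠ 0 := mod_cast h
      rcases abs_choice (1 / lam) with h' | h'
      · refine ⟨⌊|1 / lam|⁻¹ * x⌋ + 1, ?_⟩
        nth_rw 2 [h']
        push_cast
        field_simp
      · refine ⟨-(⌊|1 / lam|⁻¹ * x⌋ + 1), ?_⟩
        nth_rw 2 [h']
        push_cast
        field_simp
    rw [character_add, this, mul_one, sub_self, norm_zero]
    exact hε.le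
  · have := Int.lt_floor_add_one (|1 / lam|⁻¹ * x)
    push_cast
    calc x = |1 / lam|⁻¹ * x * |1 / lam| := by rw [mul_right_comm, h1, one_mul]
      _ < _ := by gcongr
  · have := Int.floor_le (|1 / lam|⁻¹ * x)
    push_cast
    calc _ = ⌊|1 / lam|⁻¹ * x⌋ * |1 / lam| + |1 / lam| := by ring
      _ ≤ |1 / lam|⁻¹ * x * |1 / lam| + |1 / lam| := by gcongr
      _ = x + |1 / lam| := by rw [mul_right_comm, h1, one_mul]
      _ < _ := by linarith

/-- The mean over `[-T, T]`. -/
def symmAverage (u : ℝ → ℂ) (T : ℝ) : ℂ := (1 / (2 * (T : ℂ))) * ∫ x in (-T)..T, u x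

lemma hasMeanR_iff {f : ℝ → ℂ} {lam : ℝ} {c : ℂ} :
    HasMeanR f lam c ↔
      Tendsto (symmAverage fun x => f x * character (-lam) x) atTop (𝓝 c) := by
  simp only [HasMeanR, character_neg]; rfl

lemma norm_symmAverage {u : ℝ → ℂ} {T : ℝ} (hT : 0 < T) :
    ‖symmAverage u T‖ = ‖∫ x in (-T)..T, u x‖ / (2 * T) := by
  rw [symmAverage, norm_mul, norm_div, norm_mul, norm_real, Real.norm_of_nonneg hT.le]
  simp [div_eq_inv_mul]

lemma norm_symmAverage_le {u : ℝ → ℂ} {C T : ℝ} (hu : ∀ x, ‖u x‖ ≤ C) (hT : 0 < T) :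
    ‖symmAverage u T‖ ≤ C := by
  rw [norm_symmAverage hT, div_le_iff₀ (by positivity)]
  refine (intervalIntegral.norm_integral_le_of_norm_le_const fun x _ => hu x).trans_eq ?_
  rw [abs_of_pos (by linarith)]; ring

lemma symmAverage_add {u v : ℝ → ℂ} (hu : Continuous u) (hv : Continuous v) (T : ℝ) :
    symmAverage (fun x => u x + v x) T = symmAverage u T + symmAverage v T := by
  rw [symmAverage, intervalIntegral.integral_add (hu.intervalIntegrable _ _)
    (hv.intervalIntegrable _ _), mul_add]; rfl

lemma symmAverage_sub {u v : ℝ → ℂ} (hu : Continuous u) (hv : Continuous v) (T : ℝ) :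
    symmAverage (fun x => u x - v x) T = symmAverage u T - symmAverage v T := by
  rw [symmAverage, intervalIntegral.integral_sub (hu.intervalIntegrable _ _)
    (hv.intervalIntegrable _ _), mul_sub]; rfl

lemma symmAverage_const_mul (c : ℂ) (u : ℝ → ℂ) (T : ℝ) :
    symmAverage (fun x => c * u x) T = c * symmAverage u T := by
  rw [symmAverage, intervalIntegral.integral_const_mul, mul_left_comm]; rfl

lemma symmAverage_const (c : ℂ) {T : ℝ} (hT : 0 < T) : symmAverage (fun _ => c) T = c := by
  have : (T : ℂ) ≠ 0 := mod_cast hT.ne'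
  rw [symmAverage, intervalIntegral.integral_const, Complex.real_smul]
  push_cast
  field_simp
  ring

lemma symmAverage_sum {ι : Type*} (S : Finset ι) {u : ι → ℝ → ℂ} (hu : ∀ i, Continuous (u i))
    (T : ℝ) : symmAverage (fun x => ∑ i ∈ S, u i x) T = ∑ i ∈ S, symmAverage (u i) T := by
  rw [symmAverage, intervalIntegral.integral_finsetSum fun i _ => (hu i).intervalIntegrable _ _,
    Finset.mul_sum]; rfl

lemma norm_integral_add_right_sub_le {u : ℝ → ℂ} (hu : Continuous u) {C : ℝ}
    (hC : ∀ x, ‖u x‖ ≤ C) (a b s : ℝ) :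
    ‖(∫ x in a..b, u (x + s)) - ∫ x in a..b, u x‖ ≤ 2 * C * |s| := by
  rw [intervalIntegral.integral_comp_add_right,
    intervalIntegral.integral_interval_sub_interval_comm (hu.intervalIntegrable _ _)
      (hu.intervalIntegrable _ _) (hu.intervalIntegrable _ _)]
  refine (norm_sub_le _ _).trans ?_
  have h1 := intervalIntegral.norm_integral_le_of_norm_le_const (a := a + s) (b := a)
    fun x _ => hC x
  have h2 := intervalIntegral.norm_integral_le_of_norm_le_const (a := b + s) (b := b)
    fun x _ => hC x
  rw [sub_add_cancel_left, abs_neg] at h1 h2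
  linarith

lemma APR.symmAverage_uniform {u : ℝ → ℂ} (hu : APR u) {c : ℂ}
    (h : Tendsto (symmAverage u) atTop (𝓝 c)) {ε : ℝ} (hε : 0 < ε) :
    ∃ T₀ > 0, ∀ T ≥ T₀, ∀ x, ‖symmAverage (fun t => u (t + x)) T - c‖ ≤ ε := by
  obtain ⟨C, hC, huC⟩ := hu.exists_bound
  obtain ⟨l, hl, hper⟩ := hu.2 (ε / 3) (by positivity)
  obtain ⟨T₁, hT₁⟩ := eventually_atTop.1 (Metric.tendsto_nhds.1 h (ε / 3) (by positivity))
  refine ⟨max T₁ (3 * C * l / ε), lt_max_of_lt_right (by positivity), fun T hT x => ?_⟩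
  have hT0 : 0 < T := lt_of_lt_of_le (by positivity) ((le_max_right _ _).trans hT)
  have hT3 : 3 * C * l / ε ≤ T := (le_max_right _ _).trans hT
  obtain ⟨τ, hτ, h1, h2⟩ := hper (-x)
  have hcont : ∀ y, Continuous fun t => u (t + y) := fun y => hu.1.comp (continuous_add_const y)
  have e1 : ‖symmAverage (fun t => u (t + x)) T - symmAverage (fun t => u (t + (x + τ))) T‖
      ≤ ε / 3 := by
    rw [← symmAverage_sub (hcont _) (hcont _)]
    exact norm_symmAverage_le (fun t => by simpa [add_assoc] using hτ (t + x)) hT0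
  have e2 : ‖symmAverage (fun t => u (t + (x + τ))) T - symmAverage u T‖ ≤ ε / 3 := by
    rw [symmAverage, symmAverage, ← mul_sub, norm_mul, norm_div, norm_mul, norm_real,
      Real.norm_of_nonneg hT0.le, norm_one, RCLike.norm_ofNat, div_mul_eq_mul_div, one_mul,
      div_le_iff₀ (by positivity)]
    refine (norm_integral_add_right_sub_le hu.1 huC _ _ _).trans ?_
    rw [abs_of_pos (by linarith)]
    rw [div_le_iff₀ hε] at hT3
    have : C * (x + τ) ≤ C * l := by gcongr; linarith
    linarith
  have e3 := hT₁ T ((le_max_left _ _).trans hT)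
  rw [dist_eq_norm] at e3
  calc _ = ‖(symmAverage (fun t => u (t + x)) T - symmAverage (fun t => u (t + (x + τ))) T)
        + (symmAverage (fun t => u (t + (x + τ))) T - symmAverage u T)
        + (symmAverage u T - c)‖ := by congr 1; ring
    _ ≤ _ := norm_add₃_le
    _ ≤ ε := by linarith

section Blocks

lemma norm_integral_zero_natCast_mul_le {u : ℝ → ℂ} (hu : Continuous u) {L k : ℝ}
    (h : ∀ a, ‖∫ x in a..(a + L), u x‖ ≤ k) (n : ℕ) : ‖∫ x in (0 : ℝ)..(n * L), u x‖ ≤ n * k := by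
  induction n with
  | zero => simp
  | succ n ih =>
    rw [← intervalIntegral.integral_add_adjacent_intervals (hu.intervalIntegrable 0 (n * L))
      (hu.intervalIntegrable (n * L) _)]
    refine (norm_add_le _ _).trans ?_
    have := h (n * L)
    push_cast
    rw [add_one_mul (n : ℝ) L, add_one_mul]
    linarith

lemma norm_integral_zero_le_of_blocks {u : ℝ → ℂ} (hu : Continuous u) {C L k : ℝ} (hL : 0 < L)
    (hC : ∀ x, ‖u x‖ ≤ C) (h : ∀ a, ‖∫ x in a..(a + L), u x‖ ≤ k) {T : ℝ} (hT : 0 ≤ T) :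
    ‖∫ x in (0 : ℝ)..T, u x‖ ≤ T / L * k + C * L := by
  have hk : 0 ≤ k := (norm_nonneg _).trans (h 0)
  have hC0 : 0 ≤ C := (norm_nonneg _).trans (hC 0)
  have h1 := Nat.floor_le (div_nonneg hT hL.le)
  have h2 := Nat.lt_floor_add_one (T / L)
  rw [le_div_iff₀ hL] at h1
  rw [div_lt_iff₀ hL] at h2
  rw [← intervalIntegral.integral_add_adjacent_intervals
    (hu.intervalIntegrable 0 (⌊T / L⌋₊ * L)) (hu.intervalIntegrable _ _)]
  refine (norm_add_le _ _).trans (add_le_add ?_ ?_)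
  · refine (norm_integral_zero_natCast_mul_le hu h _).trans ?_
    gcongr
    exact Nat.floor_le (div_nonneg hT hL.le)
  · refine (intervalIntegral.norm_integral_le_of_norm_le_const fun x _ => hC x).trans ?_
    rw [abs_of_nonneg (by linarith)]
    gcongr
    linarith

lemma natCast_mul_le_integral_zero {w : ℝ → ℝ} (hw : Continuous w) {L k : ℝ}
    (h : ∀ a, k ≤ ∫ x in a..(a + L), w x) (n : ℕ) : n * k ≤ ∫ x in (0 : ℝ)..(n * L), w x := by
  induction n with
  | zero => simp
  | succ n ih =>
    rw [← intervalIntegral.integral_add_adjacent_intervals (hw.intervalIntegrable 0 (n * L))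
      (hw.intervalIntegrable (n * L) _)]
    have := h (n * L)
    push_cast
    rw [add_one_mul (n : ℝ) L, add_one_mul]
    linarith

end Blocks

namespace APR

variable {f : ℝ → ℂ}

/-- A nonzero almost periodic function has a square mean bounded below. -/
lemma exists_le_integral_norm_sq (hf : APR f) {x₀ : ℝ} (hx₀ : f x₀ ≠ 0) :
    ∃ c > 0, ∃ T₀ > 0, ∀ T ≥ T₀, c * T ≤ ∫ x in (0 : ℝ)..T, ‖f x‖ ^ 2 := by
  set η := ‖f x₀‖ / 3 with hη
  have hη0 : 0 < η := by positivity
  obtain ⟨l, hl, hper⟩ := hf.2 η hη0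
  obtain ⟨δ, hδ, hδf⟩ := hf.exists_delta hη0
  have hcont : Continuous fun x => ‖f x‖ ^ 2 := by have := hf.1; fun_prop
  have hint := fun a b => hcont.intervalIntegrable (μ := volume) a b
  have hnn : ∀ᵐ x ∂volume, 0 ≤ ‖f x‖ ^ 2 := Eventually.of_forall fun x => by positivity
  have key : ∀ a, δ * η ^ 2 ≤ ∫ x in a..(a + (l + δ)), ‖f x‖ ^ 2 := fun a => by
    obtain ⟨t, ht, h1, h2⟩ := hper (a - x₀)
    have h3 : ∀ x ∈ Icc (x₀ + t) (x₀ + t + δ), η ^ 2 ≤ ‖f x‖ ^ 2 := fun x hx => by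
      have e1 := ht x₀
      have e2 := hδf (x₀ + t) (x - (x₀ + t)) (abs_le.2 ⟨by linarith [hx.1], by linarith [hx.2]⟩)
      rw [add_sub_cancel] at e2
      have e3 := norm_sub_norm_le (f x₀) (f (x₀ + t))
      have e4 := norm_sub_norm_le (f (x₀ + t)) (f x)
      gcongr
      linarith
    calc δ * η ^ 2 = ∫ _ in (x₀ + t)..(x₀ + t + δ), η ^ 2 := by simp
      _ ≤ ∫ x in (x₀ + t)..(x₀ + t + δ), ‖f x‖ ^ 2 :=
          intervalIntegral.integral_mono_on (by linarith) (by simp) (hint _ _) h3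
      _ ≤ _ := intervalIntegral.integral_mono_interval (by linarith) (by linarith) (by linarith)
          (ae_restrict_of_ae hnn) (hint _ _)
  have hL : 0 < l + δ := by positivity
  refine ⟨δ * η ^ 2 / (2 * (l + δ)), by positivity, 2 * (l + δ), by positivity, fun T hT => ?_⟩
  have hT0 : 0 ≤ T := by linarith
  have h1 := Nat.floor_le (div_nonneg hT0 hL.le)
  have h2 := Nat.lt_floor_add_one (T / (l + δ))
  rw [le_div_iff₀ hL] at h1
  have h4 : 2 ≤ T / (l + δ) := by rwa [ge_iff_le, ← le_div_iff₀ hL] at hT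
  calc δ * η ^ 2 / (2 * (l + δ)) * T = T / (l + δ) / 2 * (δ * η ^ 2) := by field_simp
    _ ≤ ⌊T / (l + δ)⌋₊ * (δ * η ^ 2) := by gcongr; linarith
    _ ≤ _ := natCast_mul_le_integral_zero hcont key _
    _ ≤ _ := intervalIntegral.integral_mono_interval le_rfl (by positivity) h1
          (ae_restrict_of_ae hnn) (hint _ _)

/-- Uniform smallness of the Fourier averages over long intervals, near a given frequency. -/
lemma exists_nhds_norm_integral_mul_character_le (hf : APR f) {lam₀ : ℝ} (h : HasMeanR f lam₀ 0)
    {ε : ℝ} (hε : 0 < ε) :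
    ∃ U ∈ 𝓝 lam₀, ∃ T₀ > 0, ∀ T ≥ T₀, ∀ lam ∈ U,
      ‖∫ x in (0 : ℝ)..T, f x * character (-lam) x‖ ≤ ε * T := by
  obtain ⟨C, hC, hfC⟩ := hf.exists_bound
  set u := fun x => f x * character (-lam₀) x with hu
  have huA : APR u := hf.mul (apr_character _)
  have huC : ∀ x, ‖u x‖ ≤ C := fun x => by simpa [hu] using hfC x
  obtain ⟨S, hS, hSu⟩ := huA.symmAverage_uniform (hasMeanR_iff.1 h) (ε := ε / 4) (by positivity)
  have hL : 0 < 2 * S := by positivity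
  have hblock : ∀ a, ‖∫ x in a..(a + 2 * S), u x‖ ≤ ε / 4 * (2 * S) := fun a => by
    have := hSu S le_rfl (a + S)
    rwa [sub_zero, norm_symmAverage hS, intervalIntegral.integral_comp_add_right,
      div_le_iff₀ hL, show -S + (a + S) = a by ring, show S + (a + S) = a + 2 * S by ring] at this
  set δ := ε / (4 * (2 * Real.pi * C * (2 * S))) with hδ
  have hδ0 : 0 < δ := by positivity
  refine ⟨Metric.closedBall lam₀ δ, Metric.closedBall_mem_nhds _ hδ0,
    2 * C * (2 * S) / ε, by positivity, fun T hT lam hlam => ?_⟩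
  have hT0 : 0 < T := lt_of_lt_of_le (by positivity) hT
  have hv : Continuous fun x => f x * character (-lam) x := hf.1.mul (continuous_character _)
  have hblock' : ∀ a, ‖∫ x in a..(a + 2 * S), f x * character (-lam) x‖ ≤ ε / 2 * (2 * S) := by
    intro a
    have e0 : ∀ x, f x * character (-lam) x - character (lam₀ - lam) a * u x
        = character (lam₀ - lam) a * u x * (character (lam₀ - lam) (x - a) - 1) := fun x => by
      have : character (-lam) x
          = character (lam₀ - lam) a * character (lam₀ - lam) (x - a) * character (-lam₀) x := by
        rw [← character_add, add_sub_cancel, ← character_add_left]; congr 1; ring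
      rw [this, hu]; ring
    have e1 : ‖(∫ x in a..(a + 2 * S), f x * character (-lam) x)
        - ∫ x in a..(a + 2 * S), character (lam₀ - lam) a * u x‖ ≤ ε / 4 * (2 * S) := by
      rw [← intervalIntegral.integral_sub (hv.intervalIntegrable _ _)
        ((huA.1.const_mul _).intervalIntegrable _ _)]
      refine (intervalIntegral.norm_integral_le_of_norm_le_const (C := ε / 4) fun x hx => ?_).trans
        (by rw [add_sub_cancel_left, abs_of_pos hL])
      rw [uIoc_of_le (by linarith)] at hx
      rw [e0, norm_mul, norm_mul, norm_character, one_mul]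
      calc ‖u x‖ * ‖character (lam₀ - lam) (x - a) - 1‖
          ≤ C * (2 * Real.pi * δ * (2 * S)) := by
            refine mul_le_mul (huC x) ((norm_character_sub_one_le _ _).trans ?_)
              (norm_nonneg _) hC.le
            gcongr
            · rw [← Real.dist_eq, dist_comm]; exact hlam
            · rw [abs_of_nonneg (by linarith [hx.1])]; linarith [hx.2]
        _ = ε / 4 := by rw [hδ]; field_simp
    have e2 : ‖∫ x in a..(a + 2 * S), character (lam₀ - lam) a * u x‖ ≤ ε / 4 * (2 * S) := by
      rw [intervalIntegral.integral_const_mul, norm_mul, norm_character, one_mul]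
      exact hblock a
    have e3 := norm_le_norm_add_norm_sub' (∫ x in a..(a + 2 * S), f x * character (-lam) x)
      (∫ x in a..(a + 2 * S), character (lam₀ - lam) a * u x)
    linarith
  refine (norm_integral_zero_le_of_blocks hv hL (C := C) (fun x => by simpa using hfC x) hblock'
    hT0.le).trans ?_
  rw [ge_iff_le, div_le_iff₀ hε] at hT
  have : T / (2 * S) * (ε / 2 * (2 * S)) = ε / 2 * T := by field_simp
  rw [this]
  linarith

/-- Uniform smallness of the Fourier averages over long intervals, at high frequencies. -/
lemma exists_norm_integral_mul_character_le_of_le_abs (hf : APR f) {ε : ℝ} (hε : 0 < ε) :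
    ∃ R > 0, ∃ T₀ > 0, ∀ T ≥ T₀, ∀ lam, R ≤ |lam| →
      ‖∫ x in (0 : ℝ)..T, f x * character (-lam) x‖ ≤ ε * T := by
  obtain ⟨C, hC, hfC⟩ := hf.exists_bound
  obtain ⟨δ, hδ, hδf⟩ := hf.exists_delta hε
  refine ⟨1 / (2 * δ), by positivity, 2 * C * δ / ε, by positivity, fun T hT lam hlam => ?_⟩
  have hT0 : 0 < T := lt_of_lt_of_le (by positivity) hT
  have hlam0 : 0 < |lam| := lt_of_lt_of_le (by positivity) hlam
  have hne : lam ≠ 0 := abs_pos.1 hlam0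
  set s := 1 / (2 * lam) with hs
  have hsδ : |s| ≤ δ := by
    rw [hs, abs_div, abs_one, abs_mul, abs_two]
    rw [div_le_iff₀ (by positivity)] at hlam ⊢
    linarith
  have hchar : ∀ x, character (-lam) (x + s) = -character (-lam) x := fun x => by
    have : character (-lam) s = -1 := by
      rw [character_eq, ← Complex.exp_neg_pi_mul_I, hs]
      congr 2
      push_cast
      have : (lam : ℂ) ≠ 0 := mod_cast hne
      field_simp
    rw [character_add, this, mul_neg_one]
  have hv : Continuous fun x => f x * character (-lam) x := hf.1.mul (continuous_character _)
  have hv' : Continuous fun x => f (x + s) * character (-lam) x :=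
    (hf.1.comp (continuous_add_const s)).mul (continuous_character _)
  have h1 := norm_integral_add_right_sub_le hv (C := C) (fun x => by simpa using hfC x) 0 T s
  have h2 : ‖(∫ x in (0 : ℝ)..T, f x * character (-lam) x)
      - ∫ x in (0 : ℝ)..T, f (x + s) * character (-lam) x‖ ≤ ε * T := by
    rw [← intervalIntegral.integral_sub (hv.intervalIntegrable _ _) (hv'.intervalIntegrable _ _)]
    refine (intervalIntegral.norm_integral_le_of_norm_le_const (C := ε) fun x _ => ?_).trans_eq
      (by rw [sub_zero, abs_of_pos hT0])
    rw [← sub_mul, norm_mul, norm_character, mul_one]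
    exact hδf x s hsδ
  simp only [hchar, mul_neg, intervalIntegral.integral_neg] at h1
  have h3 : ‖2 * ∫ x in (0 : ℝ)..T, f x * character (-lam) x‖ ≤ ε * T + 2 * C * |s| := by
    refine le_trans (le_of_eq ?_) ((norm_sub_le _ _).trans (add_le_add h2 h1))
    congr 1; ring
  rw [norm_mul, RCLike.norm_ofNat] at h3
  rw [ge_iff_le, div_le_iff₀ hε] at hT
  have : C * |s| ≤ C * δ := by gcongr
  linarith

lemma exists_norm_integral_mul_character_le (hf : APR f) (h : ∀ lam, HasMeanR f lam 0)
    {ε : ℝ} (hε : 0 < ε) :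
    ∃ T₀ > 0, ∀ T ≥ T₀, ∀ lam, ‖∫ x in (0 : ℝ)..T, f x * character (-lam) x‖ ≤ ε * T := by
  obtain ⟨R, hR, T₁, hT₁, H₁⟩ := hf.exists_norm_integral_mul_character_le_of_le_abs hε
  obtain ⟨T₂, hT₂, H₂⟩ : ∃ T₀ > 0, ∀ T ≥ T₀, ∀ lam ∈ Icc (-R) R,
      ‖∫ x in (0 : ℝ)..T, f x * character (-lam) x‖ ≤ ε * T := by
    refine (isCompact_Icc (a := -R) (b := R)).induction_on
      (p := fun U => ∃ T₀ > 0, ∀ T ≥ T₀, ∀ lam ∈ U,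
        ‖∫ x in (0 : ℝ)..T, f x * character (-lam) x‖ ≤ ε * T) ?_ ?_ ?_ ?_
    · exact ⟨1, one_pos, by simp⟩
    · rintro s t hst ⟨T₀, h0, H⟩
      exact ⟨T₀, h0, fun T hT lam hlam => H T hT lam (hst hlam)⟩
    · rintro s t ⟨T₀, h0, H⟩ ⟨T₁, h1, H'⟩
      refine ⟨max T₀ T₁, lt_max_of_lt_left h0, fun T hT lam hlam => ?_⟩
      rcases hlam with hlam | hlam
      exacts [H T ((le_max_left _ _).trans hT) lam hlam,
        H' T ((le_max_right _ _).trans hT) lam hlam]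
    · intro lam _
      obtain ⟨U, hU, H⟩ := hf.exists_nhds_norm_integral_mul_character_le (h lam) hε
      exact ⟨U, mem_nhdsWithin_of_mem_nhds hU, H⟩
  refine ⟨max T₁ T₂, lt_max_of_lt_left hT₁, fun T hT lam => ?_⟩
  rcases le_total R |lam| with h' | h'
  exacts [H₁ T ((le_max_left _ _).trans hT) lam h',
    H₂ T ((le_max_right _ _).trans hT) lam (abs_le.1 h')]

end APR

section Circle

open AddCircle

variable {T : ℝ} [Fact (0 < T)]

lemma hasSum_norm_sq_fourierCoeff {F : AddCircle T → ℂ} (hF : MemLp F 2 haarAddCircle) :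
    HasSum (fun n => ‖fourierCoeff F n‖ ^ 2) (∫ t, ‖F t‖ ^ 2 ∂haarAddCircle) := by
  have h := hasSum_sq_fourierCoeff hF.toLp
  rwa [fourierCoeff_congr_ae hF.coeFn_toLp, integral_congr_ae (g := fun t => ‖F t‖ ^ 2)
    (hF.coeFn_toLp.mono fun t ht => by simp only [ht])] at h

lemma integrable_of_bounded {X : Type*} [MeasurableSpace X] {μ : Measure X} [IsFiniteMeasure μ]
    {F : X → ℂ} (hF : AEStronglyMeasurable F μ) {C : ℝ} (hC : ∀ x, ‖F x‖ ≤ C) : Integrable F μ :=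
  Integrable.of_bound hF C (ae_of_all _ hC)

/-- The autocorrelation of a function on the circle. -/
def autocorr (F : AddCircle T → ℂ) (t : AddCircle T) : ℂ :=
  ∫ x, F (x + t) * (starRingEnd ℂ) (F x) ∂haarAddCircle

lemma norm_autocorr_le {F : AddCircle T → ℂ} {C : ℝ} (hC : ∀ x, ‖F x‖ ≤ C) (t : AddCircle T) :
    ‖autocorr F t‖ ≤ C * C := by
  have h0 : 0 ≤ C := (norm_nonneg _).trans (hC 0)
  refine (norm_integral_le_of_norm_le_const (C := C * C) (ae_of_all _ fun x => ?_)).trans (by simp)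
  rw [norm_mul, RCLike.norm_conj]
  exact mul_le_mul (hC _) (hC _) (norm_nonneg _) h0

lemma measurable_autocorr {F : AddCircle T → ℂ} (hF : Measurable F) :
    StronglyMeasurable (autocorr F) := by
  refine StronglyMeasurable.integral_prod_right
    (f := fun t x => F (x + t) * (starRingEnd ℂ) (F x)) ?_
  refine Measurable.stronglyMeasurable ?_
  exact (hF.comp (measurable_snd.add measurable_fst)).mul
    (continuous_conj.measurable.comp (hF.comp measurable_snd))

lemma fourierCoeff_autocorr {F : AddCircle T → ℂ} (hF : Measurable F) {C : ℝ}
    (hC : ∀ x, ‖F x‖ ≤ C) (n : ℤ) :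
    fourierCoeff (autocorr F) n = fourierCoeff F n * (starRingEnd ℂ) (fourierCoeff F n) := by
  have h0 : 0 ≤ C := (norm_nonneg _).trans (hC 0)
  have hmul : ∀ x t : AddCircle T, fourier (-n) t = fourier n x * fourier (-n) (t + x) := by
    intro x t
    simp only [fourier_apply, smul_add, toCircle_add, Circle.coe_mul]
    rw [mul_left_comm, ← Circle.coe_mul, ← toCircle_add]
    simp
  have key : ∀ x : AddCircle T, ∫ t, fourier (-n) t * F (x + t) ∂haarAddCircle =
      fourier n x * fourierCoeff F n := by
    intro x
    have h (t : AddCircle T) : fourier (-n) t * F (x + t) =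
        fourier n x * (fourier (-n) (t + x) * F (t + x)) := by
      rw [hmul x t, mul_assoc, add_comm x]
    simp_rw [h, integral_const_mul]
    rw [integral_add_right_eq_self (fun t => fourier (-n) t * F t) x]
    rfl
  calc fourierCoeff (autocorr F) n
      = ∫ t, ∫ x, fourier (-n) t * F (x + t) * (starRingEnd ℂ) (F x)
          ∂haarAddCircle ∂haarAddCircle := by
        simp only [fourierCoeff, autocorr, smul_eq_mul, ← integral_const_mul, mul_assoc]
    _ = ∫ x, ∫ t, fourier (-n) t * F (x + t) * (starRingEnd ℂ) (F x)
          ∂haarAddCircle ∂haarAddCircle := by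
        refine integral_integral_swap (integrable_of_bounded (C := C * C)
          (Measurable.aestronglyMeasurable ?_) ?_)
        · exact (((fourier (-n)).continuous.measurable.comp measurable_fst).mul
            (hF.comp (measurable_snd.add measurable_fst))).mul
            (continuous_conj.measurable.comp (hF.comp measurable_snd))
        · rintro ⟨t, x⟩
          simp only [Function.uncurry_apply_pair, norm_mul, RCLike.norm_conj, fourier_apply,
            Circle.norm_coe, one_mul]
          exact mul_le_mul (hC _) (hC _) (norm_nonneg _) h0
    _ = _ := by
        simp_rw [integral_mul_const, key, mul_right_comm _ (fourierCoeff F n),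
          mul_comm _ (fourierCoeff F n)]
        rw [integral_const_mul, fourierCoeff, ← integral_conj]
        congr 2 with x
        simp

lemma integral_norm_sq_autocorr_le {F : AddCircle T → ℂ} (hF : Measurable F) {C η : ℝ}
    (hC : ∀ x, ‖F x‖ ≤ C) (hη : ∀ n, ‖fourierCoeff F n‖ ≤ η) :
    ∫ t, ‖autocorr F t‖ ^ 2 ∂haarAddCircle ≤ η ^ 2 * C ^ 2 := by
  have h1 := hasSum_norm_sq_fourierCoeff
    (MemLp.of_bound hF.aestronglyMeasurable C (ae_of_all _ hC))
  have h2 := hasSum_norm_sq_fourierCoeff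
    (MemLp.of_bound (measurable_autocorr hF).aestronglyMeasurable _
      (ae_of_all _ (norm_autocorr_le hC)))
  have h3 : ∫ t, ‖autocorr F t‖ ^ 2 ∂haarAddCircle ≤
      η ^ 2 * ∫ t, ‖F t‖ ^ 2 ∂haarAddCircle := by
    refine hasSum_le (fun n => ?_) h2 (h1.mul_left _)
    rw [fourierCoeff_autocorr hF hC, norm_mul, RCLike.norm_conj, mul_pow]
    gcongr
    exact hη n
  refine h3.trans ?_
  gcongr
  calc ∫ t, ‖F t‖ ^ 2 ∂haarAddCircle ≤ ∫ _, C ^ 2 ∂(haarAddCircle : Measure (AddCircle T)) := by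
        refine integral_mono_of_nonneg (ae_of_all _ fun t => by positivity)
          (integrable_const _) (ae_of_all _ fun t => ?_)
        dsimp only
        gcongr
        exact hC t
    _ = C ^ 2 := by simp

end Circle

section Periodization

open AddCircle

variable {T : ℝ} [hT : Fact (0 < T)]

lemma integral_haarAddCircle_eq_intervalIntegral {E : Type*} [NormedAddCommGroup E]
    [NormedSpace ℝ E] (G : AddCircle T → E) :
    ∫ x, G x ∂haarAddCircle = T⁻¹ • ∫ x in (0 : ℝ)..T, G x := by
  rw [AddCircle.integral_haarAddCircle, ← AddCircle.intervalIntegral_preimage T 0, zero_add]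

lemma measurable_liftIoc {f : ℝ → ℂ} (hf : Measurable f) (a : ℝ) : Measurable (liftIoc T a f) :=
  (hf.comp measurable_subtype_coe).comp (AddCircle.measurableEquivIoc T a).measurable

lemma norm_liftIoc_le {f : ℝ → ℂ} {C : ℝ} (hC : ∀ x, ‖f x‖ ≤ C) (a : ℝ) (t : AddCircle T) :
    ‖liftIoc T a f t‖ ≤ C := hC _

lemma norm_liftIoc_sub_le {f : ℝ → ℂ} {ε : ℝ} (h : ∀ x, ‖f x - f (x + T)‖ ≤ ε) {y : ℝ}
    (h0 : 0 < y) (h1 : y ≤ T + T) : ‖liftIoc T 0 f y - f y‖ ≤ ε := by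
  rcases le_or_gt y T with hy | hy
  · rw [liftIoc_zero_coe_apply ⟨h0, hy⟩, sub_self, norm_zero]
    exact (norm_nonneg _).trans (h 0)
  · have : (y : AddCircle T) = ((y - T : ℝ) : AddCircle T) := by
      rw [AddCircle.coe_sub, AddCircle.coe_period, sub_zero]
    rw [this, liftIoc_zero_coe_apply ⟨by linarith, by linarith⟩]
    simpa using h (y - T)

lemma fourierCoeff_liftIoc_zero (f : ℝ → ℂ) (n : ℤ) :
    fourierCoeff (liftIoc T 0 f) n =
      T⁻¹ • ∫ x in (0 : ℝ)..T, f x * character (-(n / T)) x := by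
  rw [fourierCoeff, integral_haarAddCircle_eq_intervalIntegral]
  congr 1
  refine intervalIntegral.integral_congr_ae (ae_of_all _ fun x hx => ?_)
  rw [uIoc_of_le hT.out.le] at hx
  rw [liftIoc_zero_coe_apply hx, fourier_coe_apply, smul_eq_mul, mul_comm, character]
  push_cast
  congr 2
  ring

lemma norm_autocorr_liftIoc_sub_le {f : ℝ → ℂ} (hf : Continuous f) {C ε κ t : ℝ}
    (hC : ∀ x, ‖f x‖ ≤ C) (h : ∀ x, ‖f x - f (x + T)‖ ≤ ε) (ht : t ∈ Ioc 0 T)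
    (hκ : ∀ x, ‖f (x + t) - f x‖ ≤ κ) :
    ‖autocorr (liftIoc T 0 f) t - ((T⁻¹ * ∫ x in (0 : ℝ)..T, ‖f x‖ ^ 2 : ℝ) : ℂ)‖ ≤
      (ε + κ) * C := by
  have hF := measurable_liftIoc (T := T) hf.measurable 0
  have hmk : Measurable fun x : ℝ => (x : AddCircle T) := AddCircle.measurable_mk'
  have e1 : ∫ x in (0 : ℝ)..T, liftIoc T 0 f (x + t) * (starRingEnd ℂ) (liftIoc T 0 f x) =
      ∫ x in (0 : ℝ)..T, liftIoc T 0 f ((x + t : ℝ) : AddCircle T) * (starRingEnd ℂ) (f x) := by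
    refine intervalIntegral.integral_congr_ae (ae_of_all _ fun x hx => ?_)
    rw [uIoc_of_le hT.out.le] at hx
    rw [liftIoc_zero_coe_apply hx, AddCircle.coe_add]
  have e2 : ((∫ x in (0 : ℝ)..T, ‖f x‖ ^ 2 : ℝ) : ℂ) =
      ∫ x in (0 : ℝ)..T, f x * (starRingEnd ℂ) (f x) := by
    rw [← intervalIntegral.integral_ofReal]
    simp [mul_conj']
  have hfc : Continuous fun x => (starRingEnd ℂ) (f x) := continuous_conj.comp hf
  rw [autocorr, integral_haarAddCircle_eq_intervalIntegral, e1, ofReal_mul, e2,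
    ← Complex.real_smul, ← smul_sub, ← intervalIntegral.integral_sub, norm_smul, norm_inv,
    Real.norm_of_nonneg hT.out.le]
  · have := intervalIntegral.norm_integral_le_of_norm_le_const (a := 0) (b := T)
      (f := fun x => liftIoc T 0 f ((x + t : ℝ) : AddCircle T) * (starRingEnd ℂ) (f x) -
        f x * (starRingEnd ℂ) (f x)) (C := (ε + κ) * C) fun x hx => by
        rw [uIoc_of_le hT.out.le] at hx
        rw [← sub_mul, norm_mul, RCLike.norm_conj]
        have h1 := norm_liftIoc_sub_le h (y := x + t) (by linarith [hx.1, ht.1])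
          (by linarith [hx.2, ht.2])
        have h2 := norm_sub_le_norm_sub_add_norm_sub (liftIoc T 0 f ((x + t : ℝ) : AddCircle T))
          (f (x + t)) (f x)
        exact mul_le_mul (by linarith [hκ x]) (hC x) (norm_nonneg _)
          (by linarith [hκ x, norm_nonneg (f (x + t) - f x), (norm_nonneg _).trans (h 0)])
    rw [sub_zero, abs_of_pos hT.out] at this
    rw [inv_mul_le_iff₀ hT.out]
    linarith
  · refine IntervalIntegrable.mul_continuousOn ?_ hfc.continuousOn
    rw [intervalIntegrable_iff_integrableOn_Ioc_of_le hT.out.le]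
    exact integrable_of_bounded (hF.comp (hmk.comp (by fun_prop))).aestronglyMeasurable
      fun x => norm_liftIoc_le hC 0 _
  · exact (hf.mul hfc).intervalIntegrable _ _

end Periodization

namespace APR

lemma dist_shift_self {F : BoundedContinuousFunction ℝ ℂ} (hF : APR F) (δ : ℝ) :
    APR fun t => ((max 0 (δ - dist (shift F t) F) : ℝ) : ℂ) := by
  have hc := hF.continuous_shift
  refine hF.of_dist_le (by fun_prop) one_pos fun τ ε h t => ?_
  have hε : 0 ≤ ε := (norm_nonneg _).trans (h 0)
  rw [← ofReal_sub, norm_real, Real.norm_eq_abs, one_mul]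
  refine (abs_max_sub_max_le_max _ _ _ _).trans ?_
  rw [sub_self, abs_zero, sub_sub_sub_cancel_left, max_eq_right (abs_nonneg _)]
  refine (abs_dist_sub_le _ _ _).trans ((dist_shift_le hε).2 fun x => ?_)
  simpa using h x

/-- An almost periodic function all of whose Fourier coefficients vanish is zero. -/
theorem eq_zero_of_hasMeanR_zero {f : ℝ → ℂ} (hf : APR f) (h : ∀ lam, HasMeanR f lam 0) (x : ℝ) :
    f x = 0 := by
  by_contra hx
  obtain ⟨F, rfl⟩ := hf.exists_boundedContinuousFunction
  obtain ⟨C, hC, hFC⟩ := hf.exists_bound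
  obtain ⟨c, hc, T₁, hT₁, H₁⟩ := hf.exists_le_integral_norm_sq hx
  set δ := c / (4 * C) with hδ
  have hδ0 : 0 < δ := by positivity
  set v : ℝ → ℝ := fun t => max 0 (δ - dist (shift F t) F) with hv
  have hvc : Continuous v := by have := hf.continuous_shift; fun_prop
  have hv0 : ((v 0 : ℝ) : ℂ) ≠ 0 := by
    have : shift F 0 = F := by ext; simp
    simp [hv, this, hδ0]
  obtain ⟨c₂, hc₂, T₂, hT₂, H₂⟩ := (hf.dist_shift_self δ).exists_le_integral_norm_sq hv0
  obtain ⟨T₃, hT₃, H₃⟩ := hf.exists_norm_integral_mul_character_le h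
    (ε := √c₂ / 2) (by positivity)
  obtain ⟨l, hl, hper⟩ := hf.2 δ hδ0
  obtain ⟨T, hTper, hT, -⟩ := hper (max T₁ (max T₂ T₃))
  simp only [max_lt_iff] at hT
  obtain ⟨hT1, hT2, hT3⟩ := hT
  have hT0 : 0 < T := hT₁.trans hT1
  have : Fact (0 < T) := ⟨hT0⟩
  set G := AddCircle.liftIoc T 0 F
  have hGC : ∀ t, ‖G t‖ ≤ C := norm_liftIoc_le hFC 0
  have hG : Measurable G := measurable_liftIoc hf.1.measurable 0
  have hcoeff : ∀ n, ‖fourierCoeff G n‖ ≤ √c₂ / 2 := fun n => by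
    rw [fourierCoeff_liftIoc_zero, norm_smul, norm_inv, Real.norm_of_nonneg hT0.le,
      inv_mul_le_iff₀ hT0, mul_comm]
    exact H₃ T hT3.le _
  have hupper := integral_norm_sq_autocorr_le hG hGC hcoeff
  rw [integral_haarAddCircle_eq_intervalIntegral, smul_eq_mul, inv_mul_le_iff₀ hT0, div_pow,
    Real.sq_sqrt hc₂.le] at hupper
  have hlower : C ^ 2 * (c₂ * T) ≤ ∫ t in (0 : ℝ)..T, ‖autocorr G t‖ ^ 2 := by
    refine (mul_le_mul_of_nonneg_left (H₂ T hT2.le) (sq_nonneg C)).trans ?_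
    rw [← intervalIntegral.integral_const_mul]
    have hmk : Measurable fun x : ℝ => (x : AddCircle T) := AddCircle.measurable_mk'
    refine intervalIntegral.integral_mono_on_of_le_Ioo hT0.le
      (Continuous.intervalIntegrable
        (continuous_const.mul ((continuous_ofReal.comp hvc).norm.pow 2)) _ _) ?_ fun t ht => ?_
    · rw [intervalIntegrable_iff_integrableOn_Ioc_of_le hT0.le]
      refine Integrable.of_bound (C := (C * C) ^ 2)
        (((measurable_autocorr hG).measurable.comp hmk).norm.pow_const 2).aestronglyMeasurable
        (ae_of_all _ fun t => ?_)
      rw [norm_pow, norm_norm]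
      exact pow_le_pow_left₀ (norm_nonneg _) (norm_autocorr_le hGC _) 2
    · have hA := H₁ T hT1.le
      rw [← le_inv_mul_iff₀' hT0] at hA
      have hd := norm_autocorr_liftIoc_sub_le hf.1 hFC hTper ⟨ht.1, ht.2.le⟩
        (κ := dist (shift F t) F) fun x => by
          rw [← dist_eq_norm]
          exact (shift F t).dist_coe_le_dist x
      have hn := norm_sub_norm_le ((T⁻¹ * ∫ x in (0 : ℝ)..T, ‖F x‖ ^ 2 : ℝ) : ℂ) (autocorr G t)
      rw [norm_sub_rev, norm_real, Real.norm_eq_abs] at hn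
      have hcC : c = 4 * δ * C := by rw [hδ]; field_simp
      rw [← mul_pow]
      refine pow_le_pow_left₀ (by positivity) ?_ 2
      rw [norm_real, Real.norm_of_nonneg (le_max_left _ _), mul_max_of_nonneg _ _ hC.le, mul_zero]
      refine max_le (norm_nonneg _) ?_
      nlinarith [le_abs_self (T⁻¹ * ∫ x in (0 : ℝ)..T, ‖F x‖ ^ 2), mul_pos hδ0 hC]
  nlinarith [mul_pos (mul_pos hc₂ hT0) (pow_pos hC 2)]

end APR

lemma tendsto_symmAverage_character {lam : ℝ} (h : lam ≠ 0) :
    Tendsto (symmAverage (character lam)) atTop (𝓝 0) := by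
  have hc : 2 * (Real.pi : ℂ) * I * lam ≠ 0 := by simp [h, Real.pi_ne_zero]
  rw [tendsto_zero_iff_norm_tendsto_zero]
  refine squeeze_zero' (Eventually.of_forall fun _ => norm_nonneg _)
    (g := fun T : ℝ => ‖2 * (Real.pi : ℂ) * I * lam‖⁻¹ / T) ?_
    (tendsto_const_nhds.div_atTop tendsto_id)
  filter_upwards [eventually_gt_atTop 0] with T hT
  rw [norm_symmAverage hT]
  have e : ∫ x in (-T)..T, character lam x =
      (character lam T - character lam (-T)) / (2 * (Real.pi : ℂ) * I * lam) :=
    integral_exp_mul_complex hc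
  have := norm_sub_le (character lam T) (character lam (-T))
  rw [norm_character, norm_character] at this
  rw [e, norm_div, div_div, div_le_iff₀ (by positivity)]
  refine this.trans_eq ?_
  have := norm_ne_zero_iff.2 hc
  field_simp
  norm_num

lemma tendsto_symmAverage_const (c : ℂ) : Tendsto (symmAverage fun _ => c) atTop (𝓝 c) :=
  tendsto_const_nhds.congr' <|
    (eventually_gt_atTop 0).mono fun _ hT => (symmAverage_const c hT).symm

lemma HasMeanR.sub {f g : ℝ → ℂ} {lam : ℝ} {a b : ℂ} (hf : Continuous f) (hg : Continuous g)
    (ha : HasMeanR f lam a) (hb : HasMeanR g lam b) :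
    HasMeanR (fun x => f x - g x) lam (a - b) := by
  have hc := continuous_character
  rw [hasMeanR_iff] at ha hb ⊢
  refine (ha.sub hb).congr fun T => ?_
  rw [← symmAverage_sub (by fun_prop) (by fun_prop)]
  simp only [sub_mul]

lemma tendsto_symmAverage_of_tendstoUniformly {ι : Type*} {p : Filter ι} [p.NeBot]
    {u : ι → ℝ → ℂ} {v : ℝ → ℂ} {b : ι → ℂ} {c : ℂ} (hu : ∀ i, Continuous (u i))
    (huv : TendstoUniformly u v p) (hb : ∀ i, Tendsto (symmAverage (u i)) atTop (𝓝 (b i)))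
    (hbc : Tendsto b p (𝓝 c)) : Tendsto (symmAverage v) atTop (𝓝 c) := by
  have hv : Continuous v := huv.continuous (Frequently.of_forall hu)
  rw [Metric.tendsto_nhds]
  intro ε hε
  rw [Metric.tendstoUniformly_iff] at huv
  obtain ⟨i, hi1, hi2⟩ := ((huv (ε / 3) (by positivity)).and
    (Metric.tendsto_nhds.1 hbc (ε / 3) (by positivity))).exists
  filter_upwards [Metric.tendsto_nhds.1 (hb i) (ε / 3) (by positivity), eventually_gt_atTop 0]
    with T hT hT0
  have h1 : dist (symmAverage v T) (symmAverage (u i) T) ≤ ε / 3 := by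
    rw [dist_eq_norm, ← symmAverage_sub hv (hu i)]
    exact norm_symmAverage_le (fun x => by rw [← dist_eq_norm]; exact (hi1 x).le) hT0
  linarith [dist_triangle4 (symmAverage v T) (symmAverage (u i) T) (b i) c]

lemma hasMeanR_sum (S : Finset ℝ) (b : ℝ → ℂ) (lam : ℝ) :
    HasMeanR (fun x => ∑ mu ∈ S, b mu * character mu x) lam
      (∑ mu ∈ S, if mu = lam then b mu else 0) := by
  rw [hasMeanR_iff]
  have e : (fun x => (∑ mu ∈ S, b mu * character mu x) * character (-lam) x) =
      fun x => ∑ mu ∈ S, b mu * character (mu + -lam) x := by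
    ext x
    simp only [Finset.sum_mul, character_add_left, mul_assoc]
  have hc (mu : ℝ) : Continuous fun x => b mu * character (mu + -lam) x :=
    continuous_const.mul (continuous_character _)
  rw [e]
  refine Tendsto.congr (fun T => (symmAverage_sum S hc T).symm) (tendsto_finsetSum _ fun mu _ => ?_)
  refine Tendsto.congr (fun T => (symmAverage_const_mul (b mu) (character (mu + -lam)) T).symm) ?_
  split_ifs with h
  · subst h
    rw [add_neg_cancel, funext character_zero_left]
    simpa using (tendsto_symmAverage_const 1).const_mul (b mu)
  · simpa using (tendsto_symmAverage_character (lam := mu + -lam)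
      (by rwa [← sub_eq_add_neg, sub_ne_zero])).const_mul (b mu)

section Series

variable {b : ℝ → ℂ} (hb : Summable fun lam => ‖b lam‖)
include hb

lemma tendstoUniformly_series : TendstoUniformly
    (fun (S : Finset ℝ) x => ∑ lam ∈ S, b lam * character lam x)
    (fun x => ∑' lam, b lam * character lam x) atTop :=
  tendstoUniformly_tsum hb fun lam x => by rw [norm_mul, norm_character, mul_one]

lemma apr_series : APR fun x => ∑' lam, b lam * character lam x :=
  APR.of_tendstoUniformly (fun S => APR.sum S fun lam _ => (APR.const _).mul (apr_character lam))
    (tendstoUniformly_series hb)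

lemma hasMeanR_series (lam : ℝ) : HasMeanR (fun x => ∑' mu, b mu * character mu x) lam (b lam) := by
  rw [hasMeanR_iff]
  refine tendsto_symmAverage_of_tendstoUniformly (p := (atTop : Filter (Finset ℝ)))
    (b := fun S => ∑ mu ∈ S, if mu = lam then b mu else 0)
    (u := fun S x => (∑ mu ∈ S, b mu * character mu x) * character (-lam) x) (fun S => ?_) ?_
    (fun S => hasMeanR_iff.1 (hasMeanR_sum S b lam)) ?_
  · have := continuous_character
    fun_prop
  · have := tendstoUniformly_series hb
    rw [Metric.tendstoUniformly_iff] at this ⊢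
    refine fun ε hε => (this ε hε).mono fun S hS x => ?_
    rw [dist_eq_norm, ← sub_mul, norm_mul, norm_character, mul_one, ← dist_eq_norm]
    exact hS x
  · exact hasSum_single lam (fun mu hmu => if_neg hmu) |>.trans (by simp)

end Series

/-- An almost periodic function with absolutely summable Fourier coefficients is the sum of its
Fourier series. -/
theorem APR.eq_tsum {f : ℝ → ℂ} (hf : APR f) {m : ℝ → ℂ} (hm : ∀ lam, HasMeanR f lam (m lam))
    (hs : Summable fun lam => ‖m lam‖) (x : ℝ) : f x = ∑' lam, m lam * character lam x := by
  rw [← sub_eq_zero]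
  refine (hf.sub (apr_series hs)).eq_zero_of_hasMeanR_zero (fun lam => ?_) x
  simpa using (hm lam).sub hf.1 (apr_series hs).1 (hasMeanR_series hs lam)

section MeanFunctional

open scoped BoundedContinuousFunction

/-- Any ultrafilter at infinity defines a bounded linear extension of the mean. -/
lemma exists_mean_functional (p : Ultrafilter ℝ) (hp : (p : Filter ℝ) ≤ atTop) :
    ∃ M : (ℝ →ᵇ ℂ) →L[ℂ] ℂ, ∀ u : ℝ →ᵇ ℂ, Tendsto (symmAverage u) p (𝓝 (M u)) := by
  have key (u : ℝ →ᵇ ℂ) : ∃ c, ‖c‖ ≤ ‖u‖ ∧ Tendsto (symmAverage u) p (𝓝 c) := by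
    have hmem : Metric.closedBall (0 : ℂ) ‖u‖ ∈ p.map (symmAverage u) := by
      refine hp ((eventually_gt_atTop 0).mono fun T hT => ?_)
      exact mem_closedBall_zero_iff.2 (norm_symmAverage_le u.norm_coe_le_norm hT)
    obtain ⟨c, hc, hpc⟩ := (isCompact_closedBall (0 : ℂ) ‖u‖).ultrafilter_le_nhds _
      (le_principal_iff.2 hmem)
    exact ⟨c, mem_closedBall_zero_iff.1 hc, hpc⟩
  choose M hM h using key
  refine ⟨LinearMap.mkContinuous ⟨⟨M, fun u v => ?_⟩, fun c u => ?_⟩ 1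
    fun u => (hM u).trans_eq (one_mul _).symm, h⟩
  · refine tendsto_nhds_unique (h (u + v)) (((h u).add (h v)).congr fun T => ?_)
    exact (symmAverage_add u.continuous v.continuous T).symm
  · refine tendsto_nhds_unique (h (c • u)) (((h u).const_mul c).congr fun T => ?_)
    exact (symmAverage_const_mul c u T).symm

/-- `character` as a bounded continuous function. -/
def characterBCF (lam : ℝ) : ℝ →ᵇ ℂ :=
  BoundedContinuousFunction.ofNormedAddCommGroup (character lam) (continuous_character lam) 1
    fun x => (norm_character lam x).le

@[simp]
lemma characterBCF_apply (lam x : ℝ) : characterBCF lam x = character lam x := rfl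

lemma symmAverage_conj (u : ℝ → ℂ) (T : ℝ) :
    symmAverage (fun x => (starRingEnd ℂ) (u x)) T = (starRingEnd ℂ) (symmAverage u T) := by
  simp only [symmAverage, map_mul, map_div₀, map_one, map_ofNat, conj_ofReal]
  exact congrArg _ intervalIntegral.intervalIntegral_conj

lemma symmAverage_mul_conj (u : ℝ → ℂ) (T : ℝ) :
    symmAverage (fun x => u x * (starRingEnd ℂ) (u x)) T =
      ((1 / (2 * T) * ∫ x in (-T)..T, ‖u x‖ ^ 2 : ℝ) : ℂ) := by
  rw [ofReal_mul, ← intervalIntegral.integral_ofReal]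
  simp [symmAverage, mul_conj']

lemma apr_correlation {F : ℝ →ᵇ ℂ} (hF : APR F) (M : (ℝ →ᵇ ℂ) →L[ℂ] ℂ) :
    APR fun t => M (shift F t * star F) := by
  have hc := hF.continuous_shift
  refine hF.of_dist_le (C := ‖M‖ * ‖F‖ + 1) (by fun_prop) (by positivity) fun τ ε h t => ?_
  have hε : 0 ≤ ε := (norm_nonneg _).trans (h 0)
  have hd : ‖shift F t - shift F (t + τ)‖ ≤ ε := by
    rw [← dist_eq_norm, dist_comm]
    exact (dist_shift_le hε).2 fun x => by simpa using h x
  rw [← map_sub, ← sub_mul]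
  calc ‖M ((shift F t - shift F (t + τ)) * star F)‖
      ≤ ‖M‖ * (‖shift F t - shift F (t + τ)‖ * ‖star F‖) :=
        (M.le_opNorm _).trans (by gcongr; exact norm_mul_le _ _)
    _ ≤ ‖M‖ * (ε * ‖F‖) := by rw [norm_star]; gcongr
    _ ≤ (‖M‖ * ‖F‖ + 1) * ε := by linarith

lemma tendsto_average_shift {F : ℝ →ᵇ ℂ} (hF : APR F) {lam : ℝ} {c : ℂ} (h : HasMeanR F lam c) :
    Tendsto (fun T : ℝ => (1 / (2 * (T : ℂ))) • ∫ t in (-T)..T, character (-lam) t • shift F t)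
      atTop (𝓝 (c • characterBCF lam)) := by
  have hc := hF.continuous_shift
  have hch := continuous_character (-lam)
  rw [Metric.tendsto_atTop]
  intro ε hε
  obtain ⟨T₀, -, H⟩ := (hF.mul (apr_character (-lam))).symmAverage_uniform (hasMeanR_iff.1 h)
    (half_pos hε)
  refine ⟨T₀, fun T hT => lt_of_le_of_lt ?_ (half_lt_self hε)⟩
  rw [BoundedContinuousFunction.dist_le (by positivity)]
  intro x
  have e : (∫ t in (-T)..T, character (-lam) t • shift F t) x =
      ∫ t in (-T)..T, character (-lam) t * F (x + t) :=
    ((BoundedContinuousFunction.evalCLM ℂ x).intervalIntegral_comp_comm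
      (Continuous.intervalIntegrable (hch.smul hc) _ _)).symm
  have e2 : ∀ t, character (-lam) t * F (x + t) =
      character lam x * (F (t + x) * character (-lam) (t + x)) := fun t => by
    rw [character_add, add_comm x t]
    linear_combination (-(character (-lam) t * F (t + x))) * character_mul_neg lam x
  have := H T hT x
  rw [BoundedContinuousFunction.smul_apply, BoundedContinuousFunction.smul_apply, e, smul_eq_mul,
    smul_eq_mul, characterBCF_apply, dist_eq_norm]
  simp_rw [e2]
  change ‖symmAverage _ T - _‖ ≤ _
  rw [symmAverage_const_mul, mul_comm c, ← mul_sub, norm_mul, norm_character, one_mul]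
  exact this

variable {p : Filter ℝ} [p.NeBot] (hp : p ≤ atTop) {M : (ℝ →ᵇ ℂ) →L[ℂ] ℂ}
  (hM : ∀ u : ℝ →ᵇ ℂ, Tendsto (symmAverage u) p (𝓝 (M u)))
include hp hM

lemma mean_mul_star_character {H : ℝ →ᵇ ℂ} {lam : ℝ} {c : ℂ} (h : HasMeanR H lam c) :
    M (H * star (characterBCF lam)) = c := by
  refine tendsto_nhds_unique (hM _) (((hasMeanR_iff.1 h).mono_left hp).congr fun T => ?_)
  congr 1 with x
  simp [conj_character]

lemma mean_character_mul_star {H : ℝ →ᵇ ℂ} {lam : ℝ} {c : ℂ} (h : HasMeanR H lam c) :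
    M (characterBCF lam * star H) = (starRingEnd ℂ) c := by
  refine tendsto_nhds_unique (hM _) (((continuous_conj.tendsto _).comp
    ((hasMeanR_iff.1 h).mono_left hp)).congr fun T => ?_)
  rw [Function.comp_apply, ← symmAverage_conj]
  congr 1 with x
  simp [← conj_character, mul_comm]

lemma re_mean_mul_star_self_nonneg (H : ℝ →ᵇ ℂ) : 0 ≤ (M (H * star H)).re := by
  refine ge_of_tendsto ((continuous_re.tendsto _).comp (hM _)) ?_
  filter_upwards [hp (eventually_gt_atTop 0)] with T hT
  have : ⇑(H * star H) = fun x => H x * (starRingEnd ℂ) (H x) := rfl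
  rw [Function.comp_apply, this, symmAverage_mul_conj, ofReal_re]
  have : 0 ≤ ∫ x in (-T)..T, ‖H x‖ ^ 2 :=
    intervalIntegral.integral_nonneg (by linarith) fun x _ => by positivity
  positivity

/-- Bessel's inequality. -/
lemma sum_norm_sq_le {F : ℝ →ᵇ ℂ} {m : ℝ → ℂ} (hm : ∀ lam, HasMeanR F lam (m lam))
    (S : Finset ℝ) : ∑ lam ∈ S, ‖m lam‖ ^ 2 ≤ (M (F * star F)).re := by
  set P : ℝ →ᵇ ℂ := ∑ lam ∈ S, m lam • characterBCF lam with hP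
  have hPx : ⇑P = fun x => ∑ lam ∈ S, m lam * character lam x := by
    ext x; simp [hP, BoundedContinuousFunction.sum_apply]
  have hQ (lam : ℝ) (h : lam ∈ S) : HasMeanR ⇑(F - P) lam 0 := by
    have h1 := (hm lam).sub F.continuous P.continuous (hPx ▸ hasMeanR_sum S m lam)
    rw [Finset.sum_ite_eq_of_mem' S lam m h, sub_self] at h1
    exact h1
  have h1 : M (F * star P) = ∑ lam ∈ S, ((‖m lam‖ ^ 2 : ℝ) : ℂ) := by
    rw [hP, star_sum, Finset.mul_sum, map_sum]
    refine Finset.sum_congr rfl fun lam _ => ?_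
    rw [star_smul, mul_smul_comm, map_smul, mean_mul_star_character hp hM (hm lam), smul_eq_mul,
      ofReal_pow]
    exact conj_mul' _
  have h2 : M (P * star (F - P)) = 0 := by
    rw [hP, Finset.sum_mul, map_sum]
    refine Finset.sum_eq_zero fun lam h => ?_
    rw [smul_mul_assoc, map_smul, mean_character_mul_star hp hM (hQ lam h), map_zero, smul_zero]
  have h3 : F * star F = (F - P) * star (F - P) + F * star P + P * star (F - P) := by
    rw [star_sub]; ring
  rw [h3, map_add, map_add, h1, h2, add_zero, add_re, ← ofReal_sum, ofReal_re]
  linarith [re_mean_mul_star_self_nonneg hp hM (F - P)]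

lemma summable_norm_sq_of_hasMeanR {F : ℝ →ᵇ ℂ} {m : ℝ → ℂ}
    (hm : ∀ lam, HasMeanR F lam (m lam)) : Summable fun lam => ‖m lam‖ ^ 2 :=
  summable_of_sum_le (fun _ => by positivity) (sum_norm_sq_le hp hM hm)

lemma hasMeanR_correlation {F : ℝ →ᵇ ℂ} (hF : APR F) {lam : ℝ} {c : ℂ} (h : HasMeanR F lam c) :
    HasMeanR (fun t => M (shift F t * star F)) lam ((‖c‖ ^ 2 : ℝ) : ℂ) := by
  have hc := hF.continuous_shift
  have hch := continuous_character (-lam)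
  have h1 : M (c • characterBCF lam * star F) = ((‖c‖ ^ 2 : ℝ) : ℂ) := by
    rw [smul_mul_assoc, map_smul, mean_character_mul_star hp hM h, smul_eq_mul, ofReal_pow]
    exact mul_conj' _
  rw [hasMeanR_iff, ← h1]
  have hcont : Continuous fun u : ℝ →ᵇ ℂ => M (u * star F) := by fun_prop
  refine ((hcont.tendsto _).comp (tendsto_average_shift hF h)).congr fun T => ?_
  set L : (ℝ →ᵇ ℂ) →L[ℂ] ℂ := M.comp ((ContinuousLinearMap.mul ℂ (ℝ →ᵇ ℂ)).flip (star F))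
  change L (_ • _) = _
  rw [map_smul, ← L.intervalIntegral_comp_comm (Continuous.intervalIntegrable (by fun_prop) _ _)]
  simp only [map_smul, smul_eq_mul, mul_comm (character (-lam) _)]
  rfl

lemma mean_mul_star_self {F : ℝ →ᵇ ℂ} (hF : APR F) {m : ℝ → ℂ}
    (hm : ∀ lam, HasMeanR F lam (m lam)) :
    M (F * star F) = ((∑' lam, ‖m lam‖ ^ 2 : ℝ) : ℂ) := by
  have h0 : shift F 0 = F := by ext; simp
  have h := (apr_correlation hF M).eq_tsum (fun lam => hasMeanR_correlation hp hM hF (hm lam))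
    (by simpa using summable_norm_sq_of_hasMeanR hp hM hm) 0
  simpa [h0, ofReal_tsum] using h

end MeanFunctional

namespace APR

variable {f : ℝ → ℂ} {m : ℝ → ℂ}

lemma summable_norm_sq (hf : APR f) (hm : ∀ lam, HasMeanR f lam (m lam)) :
    Summable fun lam => ‖m lam‖ ^ 2 := by
  obtain ⟨F, rfl⟩ := hf.exists_boundedContinuousFunction
  obtain ⟨M, hM⟩ := exists_mean_functional (Ultrafilter.of atTop) (Ultrafilter.of_le _)
  exact summable_norm_sq_of_hasMeanR (Ultrafilter.of_le _) hM hm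

/-- Parseval's identity for almost periodic functions. -/
theorem tendsto_average_norm_sq (hf : APR f) (hm : ∀ lam, HasMeanR f lam (m lam)) :
    Tendsto (fun T : ℝ => (1 / (2 * T)) * ∫ x in (-T)..T, ‖f x‖ ^ 2) atTop
      (𝓝 (∑' lam : ℝ, ‖m lam‖ ^ 2)) := by
  obtain ⟨F, rfl⟩ := hf.exists_boundedContinuousFunction
  refine (tendsto_iff_ultrafilter _ _ _).2 fun p hp => ?_
  obtain ⟨M, hM⟩ := exists_mean_functional p hp
  have h := hM (F * star F)
  rw [mean_mul_star_self hp hM hf hm] at h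
  refine ((continuous_re.tendsto _).comp h).congr fun T => ?_
  exact congrArg re (symmAverage_mul_conj F T)

lemma hasMeanR_sub_sum (hf : APR f) (hm : ∀ lam, HasMeanR f lam (m lam)) (S : Finset ℝ)
    (lam : ℝ) : HasMeanR (fun x => f x - ∑ mu ∈ S, m mu * character mu x) lam
      ((↑S : Set ℝ)ᶜ.indicator m lam) := by
  classical
  have hc := continuous_character
  convert (hm lam).sub hf.1 (by fun_prop) (hasMeanR_sum S m lam) using 1
  by_cases h : lam ∈ S <;> simp [h]

end APR

/-- Lemma 4.3 (4)-(5): Parseval identity, mean-square approximation, and absolute/uniform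
convergence of the Fourier series when the coefficients are absolutely summable. -/
theorem stmt13 (f : ℝ → ℂ) (hf : APR f)
    (m : ℝ → ℂ) (hm : ∀ lam : ℝ, HasMeanR f lam (m lam)) :
    (Summable (fun lam : ℝ => ‖m lam‖ ^ 2) ∧
      Tendsto (fun T : ℝ => (1 / (2 * T)) * ∫ x in (-T)..T, ‖f x‖ ^ 2) atTop
        (𝓝 (∑' lam : ℝ, ‖m lam‖ ^ 2))) ∧
    (∀ ε > (0:ℝ), ∃ S : Finset ℝ, (↑S : Set ℝ) ⊆ {lam : ℝ | m lam ≠ 0} ∧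
      ∃ v : ℝ, v < ε ∧
        Tendsto (fun T : ℝ => (1 / (2 * T)) * ∫ x in (-T)..T,
            ‖f x - ∑ lam ∈ S, m lam *
              Complex.exp (2 * (Real.pi : ℂ) * Complex.I * (lam : ℂ) * (x : ℂ))‖ ^ 2)
          atTop (𝓝 v)) ∧
    (Summable (fun lam : ℝ => ‖m lam‖) →
      (∀ x : ℝ, HasSum (fun lam : ℝ => m lam *
          Complex.exp (2 * (Real.pi : ℂ) * Complex.I * (lam : ℂ) * (x : ℂ))) (f x)) ∧
      TendstoUniformly (fun (S : Finset ℝ) (x : ℝ) => ∑ lam ∈ S, m lam *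
          Complex.exp (2 * (Real.pi : ℂ) * Complex.I * (lam : ℂ) * (x : ℂ))) f atTop) := by
  have hsq := hf.summable_norm_sq hm
  refine ⟨⟨hsq, hf.tendsto_average_norm_sq hm⟩, fun ε hε => ?_, fun hs => ⟨fun x => ?_, ?_⟩⟩
  · obtain ⟨S, hS⟩ := (Metric.tendsto_nhds.1 (tendsto_tsum_compl_atTop_zero
      fun lam => ‖m lam‖ ^ 2) ε hε).exists
    have hS' := (le_abs_self _).trans_lt (by simpa [Real.dist_eq] using hS)
    have hfilter : ∀ x, ∑ lam ∈ S with m lam ≠ 0, m lam * character lam x =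
        ∑ lam ∈ S, m lam * character lam x := fun x =>
      Finset.sum_filter_of_ne fun lam _ h => left_ne_zero_of_mul h
    refine ⟨S.filter fun lam => m lam ≠ 0, fun lam h => (Finset.mem_filter.1 h).2, _, hS', ?_⟩
    have hapr : APR fun x => f x - ∑ lam ∈ S, m lam * character lam x :=
      hf.sub (APR.sum S fun lam _ => (APR.const (m lam)).mul (apr_character lam))
    have h := hapr.tendsto_average_norm_sq (hf.hasMeanR_sub_sum hm S)
    simp only [← hfilter] at h
    have htail : ∑' lam, ‖(↑S : Set ℝ)ᶜ.indicator m lam‖ ^ 2 =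
        ∑' lam : {lam // lam ∉ S}, ‖m lam‖ ^ 2 := by
      refine Eq.trans (tsum_congr fun lam => ?_)
        (tsum_subtype (↑S : Set ℝ)ᶜ fun lam => ‖m lam‖ ^ 2).symm
      by_cases hlam : lam ∈ S <;> simp [hlam]
    rwa [htail] at h
  · rw [hf.eq_tsum hm hs x]
    refine Summable.hasSum (f := fun lam => m lam * character lam x) (Summable.of_norm ?_)
    simpa [norm_mul, norm_character] using hs
  · rw [funext (hf.eq_tsum hm hs)]
    exact tendstoUniformly_series hs
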